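/- Let α1, α2, γ ∈ K and β = 3α1 − α2. (1) If γ = 0, then the two-sided ideal of 𝒦(α1,α2,0) generated by y is nilpotent; in particular 𝒦(α1,α2,0) is not semisimple. (2) If γ ≠ 0, then 𝒦(α1,α2,γ³) is a semisimple ring if and only if 4α1·γ³ + β³·(α1+α2) ≠ 0, and in that case 𝒦(α1,α2,γ³) is isomorphic as a K-algebra to the 6×6 matrix algebra M_6(K). -/

import Mathlib

noncomputable section

open FreeAlgebra

/-- The defining relations of the algebra `𝒦(α₁, α₂)`: with generators `a = ι K 0`,
`b = ι K 1`, `c = ι K 2`, `y = ι K 3`, the relations are `a² = b² = c² = α₁`,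
`ab + bc + ca = α₂` and `ac + cb + ba = α₂ + y`. -/
inductive KRel (K : Type) [Field K] (α1 α2 : K) :
    FreeAlgebra K (Fin 4) → FreeAlgebra K (Fin 4) → Prop
  | ra : KRel K α1 α2 (ι K (0 : Fin 4) * ι K (0 : Fin 4))
      (algebraMap K (FreeAlgebra K (Fin 4)) α1)
  | rb : KRel K α1 α2 (ι K (1 : Fin 4) * ι K (1 : Fin 4))
      (algebraMap K (FreeAlgebra K (Fin 4)) α1)
  | rc : KRel K α1 α2 (ι K (2 : Fin 4) * ι K (2 : Fin 4))
      (algebraMap K (FreeAlgebra K (Fin 4)) α1)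
  | r1 : KRel K α1 α2
      (ι K (0 : Fin 4) * ι K (1 : Fin 4) + ι K (1 : Fin 4) * ι K (2 : Fin 4) +
        ι K (2 : Fin 4) * ι K (0 : Fin 4))
      (algebraMap K (FreeAlgebra K (Fin 4)) α2)
  | r2 : KRel K α1 α2
      (ι K (0 : Fin 4) * ι K (2 : Fin 4) + ι K (2 : Fin 4) * ι K (1 : Fin 4) +
        ι K (1 : Fin 4) * ι K (0 : Fin 4))
      (algebraMap K (FreeAlgebra K (Fin 4)) α2 + ι K (3 : Fin 4))

/-- The algebra `𝒦(α₁, α₂)`: the quotient of the free algebra `K⟨a,b,c,y⟩` by the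
two-sided ideal generated by the relations above. -/
abbrev KAlg (K : Type) [Field K] (α1 α2 : K) : Type := RingQuot (KRel K α1 α2)

/-- The generator `a` of `𝒦(α₁, α₂)`. -/
def Ka (K : Type) [Field K] (α1 α2 : K) : KAlg K α1 α2 :=
  RingQuot.mkAlgHom K (KRel K α1 α2) (ι K (0 : Fin 4))

/-- The generator `b` of `𝒦(α₁, α₂)`. -/
def Kb (K : Type) [Field K] (α1 α2 : K) : KAlg K α1 α2 :=
  RingQuot.mkAlgHom K (KRel K α1 α2) (ι K (1 : Fin 4))

/-- The generator `c` of `𝒦(α₁, α₂)`. -/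
def Kc (K : Type) [Field K] (α1 α2 : K) : KAlg K α1 α2 :=
  RingQuot.mkAlgHom K (KRel K α1 α2) (ι K (2 : Fin 4))

/-- The generator `y` of `𝒦(α₁, α₂)`. -/
def Ky (K : Type) [Field K] (α1 α2 : K) : KAlg K α1 α2 :=
  RingQuot.mkAlgHom K (KRel K α1 α2) (ι K (3 : Fin 4))

/-- The defining relations of the algebra `𝒦(α₁, α₂, α₃)`: those of `𝒦(α₁, α₂)`
together with `y³ = α₃`. -/
inductive KRel3 (K : Type) [Field K] (α1 α2 α3 : K) :
    FreeAlgebra K (Fin 4) → FreeAlgebra K (Fin 4) → Prop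
  | base {x y : FreeAlgebra K (Fin 4)} : KRel K α1 α2 x y → KRel3 K α1 α2 α3 x y
  | r3 : KRel3 K α1 α2 α3 (ι K (3 : Fin 4) ^ 3) (algebraMap K (FreeAlgebra K (Fin 4)) α3)

/-- The algebra `𝒦(α₁, α₂, α₃) = 𝒦(α₁, α₂)/(y³ - α₃)`. -/
abbrev KAlg3 (K : Type) [Field K] (α1 α2 α3 : K) : Type := RingQuot (KRel3 K α1 α2 α3)

/-- The generator `a` of `𝒦(α₁, α₂, α₃)`. -/
def K3a (K : Type) [Field K] (α1 α2 α3 : K) : KAlg3 K α1 α2 α3 :=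
  RingQuot.mkAlgHom K (KRel3 K α1 α2 α3) (ι K (0 : Fin 4))

/-- The generator `b` of `𝒦(α₁, α₂, α₃)`. -/
def K3b (K : Type) [Field K] (α1 α2 α3 : K) : KAlg3 K α1 α2 α3 :=
  RingQuot.mkAlgHom K (KRel3 K α1 α2 α3) (ι K (1 : Fin 4))

/-- The generator `c` of `𝒦(α₁, α₂, α₃)`. -/
def K3c (K : Type) [Field K] (α1 α2 α3 : K) : KAlg3 K α1 α2 α3 :=
  RingQuot.mkAlgHom K (KRel3 K α1 α2 α3) (ι K (2 : Fin 4))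

/-- The generator `y` of `𝒦(α₁, α₂, α₃)`. -/
def K3y (K : Type) [Field K] (α1 α2 α3 : K) : KAlg3 K α1 α2 α3 :=
  RingQuot.mkAlgHom K (KRel3 K α1 α2 α3) (ι K (3 : Fin 4))

/-- A quadruple `(s, u, v, y)` satisfying the relations of `𝒦(α₁, α₂, α₃)` in the Fourier-transformed
generators `s = a + b + c`, `u = a + ωb + ω²c`, `v = a + ω²b + ωc`, where `ω² + ω + 1 = 0`. -/
structure IsFourierTuple {K T : Type} [Field K] [Ring T] [Algebra K T]
    (α1 α2 α3 ω : K) (s u v y : T) : Prop where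
  ss : s * s = (3 * α1 + 2 * α2) • (1 : T) + y
  uv : u * v = (3 * α1 - α2) • (1 : T) + ω • y
  vu : v * u = (3 * α1 - α2) • (1 : T) + (ω ^ 2) • y
  uu : u * u + s * v + v * s = 0
  vv : v * v + s * u + u * s = 0
  yyy : y ^ 3 = α3 • (1 : T)

section Lift

variable {K : Type} [Field K] {T : Type} [Ring T] [Algebra K T] {α1 α2 α3 ω : K}

/-- The algebra homomorphism out of `𝒦(α₁, α₂, α₃)` defined by images of the generators. -/
theorem KAlg3_exists_lift (a b c y : T) (ha : a * a = α1 • (1 : T)) (hb : b * b = α1 • (1 : T))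
    (hc : c * c = α1 • (1 : T)) (h1 : a * b + b * c + c * a = α2 • (1 : T))
    (h2 : a * c + c * b + b * a = α2 • (1 : T) + y) (hy : y ^ 3 = α3 • (1 : T)) :
    ∃ φ : KAlg3 K α1 α2 α3 →ₐ[K] T, φ (K3a K α1 α2 α3) = a ∧ φ (K3b K α1 α2 α3) = b ∧
      φ (K3c K α1 α2 α3) = c ∧ φ (K3y K α1 α2 α3) = y := by
  have hw : ∀ ⦃p q⦄, KRel3 K α1 α2 α3 p q →
      FreeAlgebra.lift K ![a, b, c, y] p = FreeAlgebra.lift K ![a, b, c, y] q := by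
    rintro p q (h | _)
    · cases h <;> simp [Algebra.algebraMap_eq_smul_one, ha, hb, hc, h1, h2]
    · simp [Algebra.algebraMap_eq_smul_one, hy]
  refine ⟨RingQuot.liftAlgHom K ⟨FreeAlgebra.lift K ![a, b, c, y], hw⟩, ?_, ?_, ?_, ?_⟩ <;>
    simp [K3a, K3b, K3c, K3y, RingQuot.liftAlgHom_mkAlgHom_apply]

theorem IsFourierTuple.exists_lift (h3 : (3 : K) ≠ 0) (hω : ω ^ 2 + ω + 1 = 0) {s u v y : T}
    (h : IsFourierTuple α1 α2 α3 ω s u v y) :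
    ∃ φ : KAlg3 K α1 α2 α3 →ₐ[K] T,
      φ (K3a K α1 α2 α3 + K3b K α1 α2 α3 + K3c K α1 α2 α3) = s ∧
      φ (K3a K α1 α2 α3 + ω • K3b K α1 α2 α3 + ω ^ 2 • K3c K α1 α2 α3) = u ∧
      φ (K3a K α1 α2 α3 + ω ^ 2 • K3b K α1 α2 α3 + ω • K3c K α1 α2 α3) = v ∧
      φ (K3y K α1 α2 α3) = y := by
  obtain ⟨hss, huv, hvu, huu, hvv, hy⟩ := h
  have hω2 : ω ^ 2 = -1 - ω := by linear_combination hω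
  have huu' : u * u = -(s * v) - v * s := by rw [← sub_eq_zero, ← huu]; abel
  have hvv' : v * v = -(s * u) - u * s := by rw [← sub_eq_zero, ← hvv]; abel
  obtain ⟨φ, ha, hb, hc, hyφ⟩ := KAlg3_exists_lift (K := K) (α1 := α1) (α2 := α2) (α3 := α3)
    ((3 : K)⁻¹ • (s + u + v)) ((3 : K)⁻¹ • (s + ω ^ 2 • u + ω • v))
    ((3 : K)⁻¹ • (s + ω • u + ω ^ 2 • v)) y
    (by
      simp only [mul_add, add_mul, smul_mul_assoc, mul_smul_comm, smul_add, hss, huv, hvu, huu',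
        hvv', smul_smul]
      match_scalars <;> grind)
    (by
      simp only [mul_add, add_mul, smul_mul_assoc, mul_smul_comm, smul_add, hss, huv, hvu, huu',
        hvv', smul_smul]
      match_scalars <;> grind)
    (by
      simp only [mul_add, add_mul, smul_mul_assoc, mul_smul_comm, smul_add, hss, huv, hvu, huu',
        hvv', smul_smul]
      match_scalars <;> grind)
    (by
      simp only [mul_add, add_mul, smul_mul_assoc, mul_smul_comm, smul_add, hss, huv, hvu, huu',
        hvv', smul_smul]
      match_scalars <;> grind)
    (by
      simp only [mul_add, add_mul, smul_mul_assoc, mul_smul_comm, smul_add, hss, huv, hvu, huu',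
        hvv', smul_smul]
      match_scalars <;> grind) hy
  refine ⟨φ, ?_, ?_, ?_, hyφ⟩
  all_goals
    simp only [map_add, map_smul, ha, hb, hc, smul_add, smul_smul]
    match_scalars <;> grind

end Lift

/-- The two-sided ideal generated by a normal element `y` consists of left multiples of `y`. -/
theorem exists_eq_mul_of_mem_span_of_normal {R : Type*} [Ring R] {y : R}
    (hy : ∀ d, ∃ d', y * d = d' * y) {x : R} (hx : x ∈ TwoSidedIdeal.span ({y} : Set R)) :
    ∃ d, x = d * y := by
  induction hx using TwoSidedIdeal.span_induction with
  | mem x h => exact ⟨1, by simpa using h⟩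
  | zero => exact ⟨0, by simp⟩
  | add x z _ _ hx hz =>
    obtain ⟨p, rfl⟩ := hx
    obtain ⟨q, rfl⟩ := hz
    exact ⟨p + q, (add_mul _ _ _).symm⟩
  | neg x _ hx =>
    obtain ⟨p, rfl⟩ := hx
    exact ⟨-p, (neg_mul _ _).symm⟩
  | left_absorb a x _ hx =>
    obtain ⟨p, rfl⟩ := hx
    exact ⟨a * p, (mul_assoc _ _ _).symm⟩
  | right_absorb a x _ hx =>
    obtain ⟨p, rfl⟩ := hx
    obtain ⟨a', ha⟩ := hy a
    exact ⟨p * a', by rw [mul_assoc, ha, mul_assoc]⟩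

section Presentation

variable {K : Type} [Field K] {α1 α2 α3 : K}

theorem KAlg3_induction {P : KAlg3 K α1 α2 α3 → Prop} (smul_one : ∀ r : K, P (r • 1))
    (a : P (K3a K α1 α2 α3)) (b : P (K3b K α1 α2 α3)) (c : P (K3c K α1 α2 α3))
    (y : P (K3y K α1 α2 α3)) (mul : ∀ p q, P p → P q → P (p * q))
    (add : ∀ p q, P p → P q → P (p + q)) (x : KAlg3 K α1 α2 α3) : P x := by
  obtain ⟨f, rfl⟩ := RingQuot.mkAlgHom_surjective K _ x
  induction f using FreeAlgebra.induction with
  | grade0 r => simpa [Algebra.algebraMap_eq_smul_one] using smul_one r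
  | grade1 i => fin_cases i; exacts [a, b, c, y]
  | mul p q hp hq => rw [map_mul]; exact mul _ _ hp hq
  | add p q hp hq => rw [map_add]; exact add _ _ hp hq

theorem K3a_mul_self : K3a K α1 α2 α3 * K3a K α1 α2 α3 = α1 • 1 := by
  simpa [K3a, Algebra.algebraMap_eq_smul_one] using
    RingQuot.mkAlgHom_rel K (KRel3.base (α3 := α3) (KRel.ra (K := K) (α1 := α1) (α2 := α2)))

theorem K3b_mul_self : K3b K α1 α2 α3 * K3b K α1 α2 α3 = α1 • 1 := by
  simpa [K3b, Algebra.algebraMap_eq_smul_one] using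
    RingQuot.mkAlgHom_rel K (KRel3.base (α3 := α3) (KRel.rb (K := K) (α1 := α1) (α2 := α2)))

theorem K3c_mul_self : K3c K α1 α2 α3 * K3c K α1 α2 α3 = α1 • 1 := by
  simpa [K3c, Algebra.algebraMap_eq_smul_one] using
    RingQuot.mkAlgHom_rel K (KRel3.base (α3 := α3) (KRel.rc (K := K) (α1 := α1) (α2 := α2)))

theorem K3_ab_add_bc_add_ca : K3a K α1 α2 α3 * K3b K α1 α2 α3 +
    K3b K α1 α2 α3 * K3c K α1 α2 α3 + K3c K α1 α2 α3 * K3a K α1 α2 α3 = α2 • 1 := by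
  simpa [K3a, K3b, K3c, Algebra.algebraMap_eq_smul_one] using
    RingQuot.mkAlgHom_rel K (KRel3.base (α3 := α3) (KRel.r1 (K := K) (α1 := α1) (α2 := α2)))

theorem K3_ac_add_cb_add_ba : K3a K α1 α2 α3 * K3c K α1 α2 α3 +
    K3c K α1 α2 α3 * K3b K α1 α2 α3 + K3b K α1 α2 α3 * K3a K α1 α2 α3 =
      α2 • 1 + K3y K α1 α2 α3 := by
  simpa [K3a, K3b, K3c, K3y, Algebra.algebraMap_eq_smul_one] using
    RingQuot.mkAlgHom_rel K (KRel3.base (α3 := α3) (KRel.r2 (K := K) (α1 := α1) (α2 := α2)))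

theorem K3y_pow_three : K3y K α1 α2 α3 ^ 3 = α3 • 1 := by
  simpa [K3y, Algebra.algebraMap_eq_smul_one] using
    RingQuot.mkAlgHom_rel K (KRel3.r3 (K := K) (α1 := α1) (α2 := α2) (α3 := α3))

/-- The relations of `𝒦(α₁, α₂)` force `y a = c y`. -/
theorem mul_eq_mul_of_cyclic_relations {T : Type} [Ring T] [Algebra K T] {a b c y : T}
    (ha : a * a = α1 • (1 : T)) (hc : c * c = α1 • (1 : T))
    (h1 : a * b + b * c + c * a = α2 • (1 : T))
    (h2 : a * c + c * b + b * a = α2 • (1 : T) + y) : y * a = c * y := by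
  have hy : y = a * c + c * b + b * a - α2 • (1 : T) := by rw [h2]; abel
  have e1 : a * (a * b + b * c + c * a) = α2 • a := by rw [h1]; simp
  have e2 : (a * b + b * c + c * a) * c = α2 • c := by rw [h1]; simp
  have e3 : a * (a * b) = α1 • b := by rw [← mul_assoc, ha]; simp
  have e4 : b * c * c = α1 • b := by rw [mul_assoc, hc]; simp
  have e5 : b * a * a = α1 • b := by rw [mul_assoc, ha]; simp
  have e6 : c * (c * b) = α1 • b := by rw [← mul_assoc, hc]; simp
  have e7 : a * c * a - c * a * c = α2 • a - α2 • c := by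
    rw [← e1, ← e2, mul_add, mul_add, add_mul, add_mul, e3, e4]
    noncomm_ring
  have e8 : y * a - c * y =
      a * c * a - c * a * c + (b * a * a - c * (c * b)) - (α2 • a - α2 • c) := by
    rw [hy]
    simp only [sub_mul, add_mul, mul_sub, mul_add, smul_mul_assoc, mul_smul_comm, one_mul, mul_one]
    noncomm_ring
  rw [← sub_eq_zero, e8, e7, e5, e6]
  abel

theorem K3y_mul_K3a : K3y K α1 α2 α3 * K3a K α1 α2 α3 = K3c K α1 α2 α3 * K3y K α1 α2 α3 :=
  mul_eq_mul_of_cyclic_relations K3a_mul_self K3c_mul_self K3_ab_add_bc_add_ca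
    K3_ac_add_cb_add_ba

theorem K3y_mul_K3b : K3y K α1 α2 α3 * K3b K α1 α2 α3 = K3a K α1 α2 α3 * K3y K α1 α2 α3 :=
  mul_eq_mul_of_cyclic_relations (b := K3c K α1 α2 α3) K3b_mul_self K3a_mul_self
    (by rw [← K3_ab_add_bc_add_ca]; abel) (by rw [← K3_ac_add_cb_add_ba]; abel)

theorem K3y_mul_K3c : K3y K α1 α2 α3 * K3c K α1 α2 α3 = K3b K α1 α2 α3 * K3y K α1 α2 α3 :=
  mul_eq_mul_of_cyclic_relations (b := K3a K α1 α2 α3) K3c_mul_self K3b_mul_self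
    (by rw [← K3_ab_add_bc_add_ca]; abel) (by rw [← K3_ac_add_cb_add_ba]; abel)

/-- The element `y` is normal. -/
theorem exists_K3y_mul_eq (d : KAlg3 K α1 α2 α3) :
    ∃ d', K3y K α1 α2 α3 * d = d' * K3y K α1 α2 α3 := by
  induction d using KAlg3_induction with
  | smul_one r => exact ⟨r • 1, by simp⟩
  | a => exact ⟨_, K3y_mul_K3a⟩
  | b => exact ⟨_, K3y_mul_K3b⟩
  | c => exact ⟨_, K3y_mul_K3c⟩
  | y => exact ⟨_, rfl⟩
  | mul p q hp hq =>
    obtain ⟨p', hp⟩ := hp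
    obtain ⟨q', hq⟩ := hq
    exact ⟨p' * q', by rw [← mul_assoc, hp, mul_assoc, hq, mul_assoc]⟩
  | add p q hp hq =>
    obtain ⟨p', hp⟩ := hp
    obtain ⟨q', hq⟩ := hq
    exact ⟨p' + q', by rw [mul_add, hp, hq, add_mul]⟩

theorem mul_mul_eq_zero_of_mem_span_K3y {x₁ x₂ x₃ : KAlg3 K α1 α2 0}
    (h₁ : x₁ ∈ TwoSidedIdeal.span ({K3y K α1 α2 0} : Set (KAlg3 K α1 α2 0)))
    (h₂ : x₂ ∈ TwoSidedIdeal.span ({K3y K α1 α2 0} : Set (KAlg3 K α1 α2 0)))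
    (h₃ : x₃ ∈ TwoSidedIdeal.span ({K3y K α1 α2 0} : Set (KAlg3 K α1 α2 0))) :
    x₁ * (x₂ * x₃) = 0 := by
  obtain ⟨d₁, rfl⟩ := exists_eq_mul_of_mem_span_of_normal exists_K3y_mul_eq h₁
  obtain ⟨d₂, rfl⟩ := exists_eq_mul_of_mem_span_of_normal exists_K3y_mul_eq h₂
  obtain ⟨d₃, rfl⟩ := exists_eq_mul_of_mem_span_of_normal exists_K3y_mul_eq h₃
  obtain ⟨e₃, h₃⟩ := exists_K3y_mul_eq d₃
  obtain ⟨e₂, h₂⟩ := exists_K3y_mul_eq (d₂ * e₃)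
  have hy : K3y K α1 α2 0 * (K3y K α1 α2 0 * K3y K α1 α2 0) = 0 := by
    have := K3y_pow_three (K := K) (α1 := α1) (α2 := α2) (α3 := 0)
    rwa [pow_three, zero_smul] at this
  calc d₁ * K3y K α1 α2 0 * (d₂ * K3y K α1 α2 0 * (d₃ * K3y K α1 α2 0))
      = d₁ * (K3y K α1 α2 0 * (d₂ * (K3y K α1 α2 0 * d₃))) * K3y K α1 α2 0 := by
        simp only [mul_assoc]
    _ = d₁ * (K3y K α1 α2 0 * (d₂ * e₃)) * (K3y K α1 α2 0 * K3y K α1 α2 0) := by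
        rw [h₃]; simp only [mul_assoc]
    _ = d₁ * e₂ * (K3y K α1 α2 0 * (K3y K α1 α2 0 * K3y K α1 α2 0)) := by
        rw [h₂]; simp only [mul_assoc]
    _ = 0 := by rw [hy, mul_zero]

end Presentation

/-- Semisimple rings are von Neumann regular. -/
theorem IsSemisimpleRing.exists_mul_mul_eq {R : Type*} [Ring R] [IsSemisimpleRing R] (x : R) :
    ∃ c, x * c * x = x := by
  obtain ⟨Q, hQ⟩ := exists_isCompl (Submodule.span R {x})
  have h1 : (1 : R) ∈ Submodule.span R {x} ⊔ Q := by rw [hQ.sup_eq_top]; trivial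
  obtain ⟨p, hp, q, hq, hpq⟩ := Submodule.mem_sup.1 h1
  obtain ⟨c, rfl⟩ := Submodule.mem_span_singleton.1 hp
  refine ⟨c, ?_⟩
  have hxq : x * q = x - x * c * x := by
    rw [← eq_sub_iff_add_eq'] at hpq
    rw [hpq, smul_eq_mul]
    noncomm_ring
  have : x * q ∈ Submodule.span R {x} ⊓ Q := by
    refine ⟨?_, Q.smul_mem x hq⟩
    rw [hxq]
    exact Submodule.mem_span_singleton.2 ⟨1 - x * c, by rw [smul_eq_mul]; noncomm_ring⟩
  rw [hQ.inf_eq_bot, Submodule.mem_bot, hxq, sub_eq_zero] at this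
  exact this.symm

section Spanning

variable {K : Type} [Field K] {T : Type} [Ring T] [Algebra K T] {α1 α2 α3 ω : K} {s u v y : T}

theorem IsFourierTuple.u_cube_eq_v_cube (h : IsFourierTuple α1 α2 α3 ω s u v y) :
    u * (u * u) = v * (v * v) := by
  have huu : u * u = -(s * v) - v * s := by rw [← sub_eq_zero, ← h.uu]; abel
  have hvv : v * v = -(s * u) - u * s := by rw [← sub_eq_zero, ← h.vv]; abel
  calc u * (u * u) = -(u * s * v) - u * v * s := by rw [huu]; noncomm_ring
    _ = -(u * s * v) - s * (u * v) + (s * y - y * s) * (algebraMap K T ω) := by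
      rw [h.uv]
      simp only [add_mul, mul_add, smul_mul_assoc, mul_smul_comm, one_mul, mul_one,
        Algebra.algebraMap_eq_smul_one]
      module
    _ = -(u * s * v) - s * (u * v) := by
      have : s * y = y * s := by
        have hy : y = s * s - (3 * α1 + 2 * α2) • (1 : T) := by rw [h.ss]; abel
        rw [hy]; simp [mul_sub, sub_mul, mul_assoc]
      rw [this, sub_self, zero_mul, add_zero]
    _ = v * v * v := by rw [hvv]; noncomm_ring
    _ = v * (v * v) := mul_assoc _ _ _

/-- The `K`-span of the monomials `yⁱ w` with `w` one of `1, u, u², u³, v, v²`. -/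
def fourierSpan (K : Type) [Field K] {T : Type} [Ring T] [Algebra K T] (u v y : T) :
    Submodule K T :=
  Submodule.span K (Set.range fun p : Fin 3 × Fin 6 =>
    y ^ (p.1 : ℕ) * ![1, u, u * u, u * (u * u), v, v * v] p.2)

instance : Module.Finite K (fourierSpan K u v y) :=
  Module.Finite.span_of_finite K (Set.finite_range _)

theorem finrank_fourierSpan_le : Module.finrank K (fourierSpan K u v y) ≤ 18 :=
  (finrank_range_le_card _).trans (by simp)

theorem mem_fourierSpan (j : Fin 6) :
    ![1, u, u * u, u * (u * u), v, v * v] j ∈ fourierSpan K u v y :=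
  Submodule.subset_span ⟨(0, j), by simp⟩

theorem y_mul_mem_fourierSpan (hy : y ^ 3 = α3 • (1 : T)) {m : T}
    (hm : m ∈ fourierSpan K u v y) : y * m ∈ fourierSpan K u v y := by
  induction hm using Submodule.span_induction with
  | mem x hx =>
    obtain ⟨⟨i, j⟩, rfl⟩ := hx
    dsimp only
    rw [← mul_assoc, ← pow_succ']
    by_cases hi : (i : ℕ) + 1 < 3
    · exact Submodule.subset_span ⟨(⟨i + 1, hi⟩, j), rfl⟩
    · rw [show (i : ℕ) + 1 = 3 by omega, hy, smul_mul_assoc, one_mul]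
      exact Submodule.smul_mem _ _ (mem_fourierSpan j)
  | zero => simp
  | add p q _ _ hp hq => rw [mul_add]; exact add_mem hp hq
  | smul r p _ hp => rw [mul_smul_comm]; exact Submodule.smul_mem _ _ hp

theorem mul_mem_fourierSpan (hy : y ^ 3 = α3 • (1 : T)) {x : T} {r : K} (hxy : x * y = r • (y * x))
    (hx : ∀ j, x * ![1, u, u * u, u * (u * u), v, v * v] j ∈ fourierSpan K u v y) {m : T}
    (hm : m ∈ fourierSpan K u v y) : x * m ∈ fourierSpan K u v y := by
  have hpow : ∀ (i : ℕ) (w : T), x * w ∈ fourierSpan K u v y →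
      x * (y ^ i * w) ∈ fourierSpan K u v y := by
    intro i
    induction i with
    | zero => intro w hw; simpa using hw
    | succ i ih =>
      intro w hw
      rw [pow_succ', mul_assoc, ← mul_assoc, hxy, smul_mul_assoc, mul_assoc]
      exact Submodule.smul_mem _ _ (y_mul_mem_fourierSpan hy (ih w hw))
  induction hm using Submodule.span_induction with
  | mem w hw =>
    obtain ⟨⟨i, j⟩, rfl⟩ := hw
    exact hpow _ _ (hx j)
  | zero => simp
  | add p q _ _ hp hq => rw [mul_add]; exact add_mem hp hq
  | smul r p _ hp => rw [mul_smul_comm]; exact Submodule.smul_mem _ _ hp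

theorem IsFourierTuple.u_mul_mem_fourierSpan (h : IsFourierTuple α1 α2 α3 ω s u v y)
    {r : K} (huy : u * y = r • (y * u)) {m : T} (hm : m ∈ fourierSpan K u v y) :
    u * m ∈ fourierSpan K u v y := by
  have key : ∀ j, u * v * ![1, u, u * u, u * (u * u), v, v * v] j ∈ fourierSpan K u v y := by
    intro j
    rw [h.uv, add_mul, smul_mul_assoc, smul_mul_assoc, one_mul]
    exact add_mem (Submodule.smul_mem _ _ (mem_fourierSpan j))
      (Submodule.smul_mem _ _ (y_mul_mem_fourierSpan h.yyy (mem_fourierSpan j)))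
  refine mul_mem_fourierSpan h.yyy huy (fun j => ?_) hm
  fin_cases j
  · simpa using mem_fourierSpan (K := K) (u := u) (v := v) (y := y) 1
  · simpa using mem_fourierSpan (K := K) (u := u) (v := v) (y := y) 2
  · simpa using mem_fourierSpan (K := K) (u := u) (v := v) (y := y) 3
  · simpa [h.u_cube_eq_v_cube, mul_assoc] using key 5
  · simpa [mul_assoc] using key 0
  · simpa [mul_assoc] using key 4

theorem IsFourierTuple.v_mul_mem_fourierSpan (h : IsFourierTuple α1 α2 α3 ω s u v y)
    {r : K} (hvy : v * y = r • (y * v)) {m : T} (hm : m ∈ fourierSpan K u v y) :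
    v * m ∈ fourierSpan K u v y := by
  have key : ∀ j, v * u * ![1, u, u * u, u * (u * u), v, v * v] j ∈ fourierSpan K u v y := by
    intro j
    rw [h.vu, add_mul, smul_mul_assoc, smul_mul_assoc, one_mul]
    exact add_mem (Submodule.smul_mem _ _ (mem_fourierSpan j))
      (Submodule.smul_mem _ _ (y_mul_mem_fourierSpan h.yyy (mem_fourierSpan j)))
  refine mul_mem_fourierSpan h.yyy hvy (fun j => ?_) hm
  fin_cases j
  · simpa using mem_fourierSpan (K := K) (u := u) (v := v) (y := y) 4
  · simpa [mul_assoc] using key 0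
  · simpa [mul_assoc] using key 1
  · simpa [mul_assoc] using key 2
  · simpa using mem_fourierSpan (K := K) (u := u) (v := v) (y := y) 5
  · simpa [h.u_cube_eq_v_cube] using mem_fourierSpan (K := K) (u := u) (v := v) (y := y) 3

/-- A subspace of dimension at most `36` containing `1` and stable under left multiplication by
the Fourier generators. -/
theorem IsFourierTuple.exists_stable_submodule (h : IsFourierTuple α1 α2 α3 ω s u v y)
    (hsy : y * s = s * y) {r r' : K} (huy : u * y = r • (y * u)) (hvy : v * y = r' • (y * v)) :
    ∃ M : Submodule K T, Module.Finite K M ∧ Module.finrank K M ≤ 36 ∧ 1 ∈ M ∧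
      (∀ m ∈ M, s * m ∈ M) ∧ (∀ m ∈ M, u * m ∈ M) ∧ (∀ m ∈ M, v * m ∈ M) ∧
      (∀ m ∈ M, y * m ∈ M) := by
  set N := fourierSpan K u v y
  have hu : ∀ m ∈ N, u * m ∈ N := fun m hm => h.u_mul_mem_fourierSpan huy hm
  have hv : ∀ m ∈ N, v * m ∈ N := fun m hm => h.v_mul_mem_fourierSpan hvy hm
  have hy : ∀ m ∈ N, y * m ∈ N := fun m hm => y_mul_mem_fourierSpan h.yyy hm
  have mem : ∀ p q : T, p ∈ N → q ∈ N →
      p + s * q ∈ N ⊔ N.map (LinearMap.mulLeft K s) := fun p q hp hq =>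
    Submodule.add_mem_sup hp ⟨q, hq, rfl⟩
  have cases : ∀ m ∈ N ⊔ N.map (LinearMap.mulLeft K s), ∃ p ∈ N, ∃ q ∈ N, m = p + s * q := by
    intro m hm
    obtain ⟨p, hp, _, ⟨q, hq, rfl⟩, rfl⟩ := Submodule.mem_sup.1 hm
    exact ⟨p, hp, q, hq, rfl⟩
  refine ⟨N ⊔ N.map (LinearMap.mulLeft K s), inferInstance, ?_, ?_, ?_, ?_, ?_, ?_⟩
  · calc _ ≤ Module.finrank K N + Module.finrank K (N.map (LinearMap.mulLeft K s)) :=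
          Submodule.finrank_add_le_finrank_add_finrank _ _
      _ ≤ Module.finrank K N + Module.finrank K N := by
          gcongr; exact Submodule.finrank_map_le _ _
      _ ≤ 18 + 18 := add_le_add finrank_fourierSpan_le finrank_fourierSpan_le
      _ = 36 := rfl
  · exact Submodule.mem_sup_left (by simpa using mem_fourierSpan (K := K) (u := u) (v := v) (y := y) 0)
  · intro m hm
    obtain ⟨p, hp, q, hq, rfl⟩ := cases m hm
    have : s * (p + s * q) = ((3 * α1 + 2 * α2) • q + y * q) + s * p := by
      rw [mul_add, ← mul_assoc, h.ss, add_mul, smul_mul_assoc, one_mul]; abel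
    rw [this]
    exact mem _ _ (add_mem (Submodule.smul_mem _ _ hq) (hy q hq)) hp
  · intro m hm
    obtain ⟨p, hp, q, hq, rfl⟩ := cases m hm
    have hus : u * s = -(v * v) - s * u := by rw [← sub_eq_zero, ← h.vv]; abel
    have : u * (p + s * q) = (u * p - v * (v * q)) + s * (-(u * q)) := by
      rw [mul_add, ← mul_assoc, hus]; noncomm_ring
    rw [this]
    exact mem _ _ (sub_mem (hu p hp) (hv _ (hv q hq))) (neg_mem (hu q hq))
  · intro m hm
    obtain ⟨p, hp, q, hq, rfl⟩ := cases m hm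
    have hvs : v * s = -(u * u) - s * v := by rw [← sub_eq_zero, ← h.uu]; abel
    have : v * (p + s * q) = (v * p - u * (u * q)) + s * (-(v * q)) := by
      rw [mul_add, ← mul_assoc, hvs]; noncomm_ring
    rw [this]
    exact mem _ _ (sub_mem (hv p hp) (hu _ (hu q hq))) (neg_mem (hv q hq))
  · intro m hm
    obtain ⟨p, hp, q, hq, rfl⟩ := cases m hm
    have : y * (p + s * q) = y * p + s * (y * q) := by
      rw [mul_add, ← mul_assoc, hsy, mul_assoc]
    rw [this]
    exact mem _ _ (hy p hp) (hy q hq)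

theorem isFourierTuple_K3 (hω : ω ^ 2 + ω + 1 = 0) : IsFourierTuple α1 α2 α3 ω
    (K3a K α1 α2 α3 + K3b K α1 α2 α3 + K3c K α1 α2 α3)
    (K3a K α1 α2 α3 + ω • K3b K α1 α2 α3 + ω ^ 2 • K3c K α1 α2 α3)
    (K3a K α1 α2 α3 + ω ^ 2 • K3b K α1 α2 α3 + ω • K3c K α1 α2 α3) (K3y K α1 α2 α3) := by
  have ha := K3a_mul_self (K := K) (α1 := α1) (α2 := α2) (α3 := α3)
  have hb := K3b_mul_self (K := K) (α1 := α1) (α2 := α2) (α3 := α3)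
  have hc := K3c_mul_self (K := K) (α1 := α1) (α2 := α2) (α3 := α3)
  have h1 := K3_ab_add_bc_add_ca (K := K) (α1 := α1) (α2 := α2) (α3 := α3)
  have h2 := K3_ac_add_cb_add_ba (K := K) (α1 := α1) (α2 := α2) (α3 := α3)
  have hy := K3y_pow_three (K := K) (α1 := α1) (α2 := α2) (α3 := α3)
  generalize K3a K α1 α2 α3 = a at *
  generalize K3b K α1 α2 α3 = b at *
  generalize K3c K α1 α2 α3 = c at *
  generalize K3y K α1 α2 α3 = y at *
  have h1' : c * a = α2 • 1 - a * b - b * c := by rw [← h1]; abel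
  have h2' : b * a = α2 • 1 + y - a * c - c * b := by rw [← h2]; abel
  constructor
  case yyy => exact hy
  all_goals
    simp only [mul_add, add_mul, smul_mul_assoc, mul_smul_comm, smul_add, ha, hb, hc, h1', h2',
      smul_smul]
    match_scalars <;> grind

theorem KAlg3_finite_and_finrank_le (h3 : (3 : K) ≠ 0) (hω : ω ^ 2 + ω + 1 = 0) :
    Module.Finite K (KAlg3 K α1 α2 α3) ∧ Module.finrank K (KAlg3 K α1 α2 α3) ≤ 36 := by
  have hf := isFourierTuple_K3 (α1 := α1) (α2 := α2) (α3 := α3) hω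
  have ya := K3y_mul_K3a (K := K) (α1 := α1) (α2 := α2) (α3 := α3)
  have yb := K3y_mul_K3b (K := K) (α1 := α1) (α2 := α2) (α3 := α3)
  have yc := K3y_mul_K3c (K := K) (α1 := α1) (α2 := α2) (α3 := α3)
  have hω2 : ω ^ 2 = -1 - ω := by linear_combination hω
  obtain ⟨M, hfin, hrank, h1, hs, hu, hv, hy⟩ := hf.exists_stable_submodule (r := ω ^ 2) (r' := ω)
    (by simp only [mul_add, add_mul, ya, yb, yc]; abel)
    (by
      simp only [mul_add, add_mul, smul_mul_assoc, mul_smul_comm, ya, yb, yc]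
      match_scalars <;> grind)
    (by
      simp only [mul_add, add_mul, smul_mul_assoc, mul_smul_comm, ya, yb, yc]
      match_scalars <;> grind)
  have hgen : ∀ r r' : K, ∀ m ∈ M, ((3 : K)⁻¹ •
      ((K3a K α1 α2 α3 + K3b K α1 α2 α3 + K3c K α1 α2 α3) +
      r • (K3a K α1 α2 α3 + ω • K3b K α1 α2 α3 + ω ^ 2 • K3c K α1 α2 α3) +
      r' • (K3a K α1 α2 α3 + ω ^ 2 • K3b K α1 α2 α3 + ω • K3c K α1 α2 α3))) * m ∈ M := by
    intro r r' m hm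
    rw [smul_mul_assoc, add_mul, add_mul, smul_mul_assoc r, smul_mul_assoc r']
    exact M.smul_mem _ (add_mem (add_mem (hs m hm) (M.smul_mem _ (hu m hm)))
      (M.smul_mem _ (hv m hm)))
  have hstable : ∀ x : KAlg3 K α1 α2 α3, ∀ m ∈ M, x * m ∈ M := by
    intro x
    induction x using KAlg3_induction with
    | smul_one r => intro m hm; simpa using M.smul_mem r hm
    | a =>
      intro m hm
      convert hgen 1 1 m hm using 2
      match_scalars <;> grind
    | b =>
      intro m hm
      convert hgen (ω ^ 2) ω m hm using 2
      match_scalars <;> grind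
    | c =>
      intro m hm
      convert hgen ω (ω ^ 2) m hm using 2
      match_scalars <;> grind
    | y => exact hy
    | mul p q hp hq => intro m hm; rw [mul_assoc]; exact hp _ (hq m hm)
    | add p q hp hq => intro m hm; rw [add_mul]; exact add_mem (hp m hm) (hq m hm)
  have htop : M = ⊤ := by
    rw [eq_top_iff]
    intro x _
    simpa using hstable x 1 h1
  subst htop
  exact ⟨Module.finite_def.2 (Module.Finite.iff_fg.1 hfin), by rwa [finrank_top] at hrank⟩

end Spanning

section Representations

variable {K : Type} [Field K] {α1 α2 γ ω : K}

set_option maxHeartbeats 1000000 in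
/-- Elements `S`, `Z` with the relations of the Clifford algebra of `q_γ` in an algebra `T` yield a
representation of `𝒦(α₁, α₂, γ³)` over `T`, in which `y` is diagonal. -/
theorem isFourierTuple_block {T : Type} [Ring T] [Algebra K T] {S Z : T} {β P Q : K}
    (hω : ω ^ 2 + ω + 1 = 0) (hβ : 3 * α1 - α2 = β)
    (hP : (β + ω ^ 2 * γ) * P = 1) (hQ : (β + γ) * Q = 1)
    (hS : S * S = (3 * α1 + 2 * α2 + γ) • (1 : T))
    (hZ : Z * Z = (β ^ 3 + γ ^ 3) • (1 : T))
    (hSZ : S * Z + Z * S = (2 * γ ^ 2 - 2 * β * γ - β ^ 2) • (1 : T)) :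
    IsFourierTuple α1 α2 (γ ^ 3) ω
      (!![S, 0, 0; 0, -S - P • Z, 0; 0, 0, S + (P - Q) • Z] : Matrix _ _ T)
      !![0, 0, Z; 1, 0, 0; 0, 1, 0]
      !![0, (β + ω ^ 2 * γ) • 1, 0; 0, 0, (β + γ) • 1; (P * Q) • Z, 0, 0]
      !![γ • 1, 0, 0; 0, (ω * γ) • 1, 0; 0, 0, (ω ^ 2 * γ) • 1] := by
  have hω3 : ω ^ 3 = 1 := by linear_combination (ω - 1) * hω
  have hSZ' : S * Z = (2 * γ ^ 2 - 2 * β * γ - β ^ 2) • (1 : T) - Z * S := by rw [← hSZ]; abel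
  constructor
  case yyy =>
    ext i j
    fin_cases i <;> fin_cases j <;>
      simp [pow_succ, Matrix.mul_apply, Fin.sum_univ_three, smul_smul, Matrix.smul_apply]
    all_goals
      match_scalars
    all_goals
      clear hS hZ hSZ hSZ'
      grind
  all_goals
    try rw [hβ]
    ext i j
    fin_cases i <;> fin_cases j <;>
      simp [Matrix.mul_apply, Fin.sum_univ_three, Matrix.smul_apply, mul_add, add_mul, mul_sub,
        sub_mul, hS, hZ, hSZ', smul_smul, smul_sub, smul_add, -neg_add_rev]
    all_goals
      match_scalars
    all_goals
      clear hS hZ hSZ hSZ'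
      grind

set_option maxHeartbeats 1000000 in
/-- A representation of `𝒦(α₁, α₂, 0)` in which `y` acts nontrivially. -/
theorem isFourierTuple_nilpotent {x : K} (hω : ω ^ 2 + ω + 1 = 0) (hx : x ^ 2 = 9 * α1) :
    IsFourierTuple α1 α2 0 ω
      !![x, -2 * (3 * α1 - α2), 0, 0; 1, -x, 0, 0; 0, 1, x, -2 * (3 * α1 - α2); 0, 0, 1, -x]
      !![0, 3 * α1 - α2, 0, 0; 1, 0, 0, 0; 0, ω, 0, ω ^ 2 * (3 * α1 - α2); 0, 0, ω ^ 2, 0]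
      !![0, 3 * α1 - α2, 0, 0; 1, 0, 0, 0; 0, ω ^ 2, 0, ω * (3 * α1 - α2); 0, 0, ω, 0]
      !![0, 0, 0, 0; 0, 0, 0, 0; 1, 0, 0, 0; 0, 1, 0, 0] := by
  have hω3 : ω ^ 3 = 1 := by linear_combination (ω - 1) * hω
  constructor
  all_goals
    ext i j
    fin_cases i <;> fin_cases j <;>
      simp [pow_three, Matrix.mul_apply, Fin.sum_univ_four, -neg_add_rev]
    all_goals grind

end Representations

section BlockMatrices

open Matrix

variable {K : Type} [Field K] {T : Type} [Ring T] [Algebra K T]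

theorem single_zero_zero_eq {γ ω : K} (h3 : (3 : K) ≠ 0) (hγ : γ ≠ 0) (hω : ω ^ 2 + ω + 1 = 0)
    {y : Matrix (Fin 3) (Fin 3) T}
    (hy : y = !![γ • 1, 0, 0; 0, (ω * γ) • 1, 0; 0, 0, (ω ^ 2 * γ) • 1]) :
    (3 * γ ^ 2)⁻¹ • (y * y + γ • y + γ ^ 2 • 1) = single 0 0 1 := by
  have hω3 : ω ^ 3 = 1 := by linear_combination (ω - 1) * hω
  subst hy
  ext i j
  fin_cases i <;> fin_cases j <;>
    simp [smul_smul, smul_add]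
  all_goals
    match_scalars
    grind

/-- A subalgebra of `M₃(T)` containing suitable block matrices is everything. -/
theorem eq_top_of_block_mem {S S₁ S₂ Z Z' : T} {p q : K} (hp : p ≠ 0) (hq : q ≠ 0)
    (B : Subalgebra K (Matrix (Fin 3) (Fin 3) T)) (he : single 0 0 1 ∈ B)
    (hs : !![S, 0, 0; 0, S₁, 0; 0, 0, S₂] ∈ B) (hu : !![0, 0, Z; 1, 0, 0; 0, 1, 0] ∈ B)
    (hv : !![0, p • 1, 0; 0, 0, q • 1; Z', 0, 0] ∈ B) (hT : Algebra.adjoin K {S, Z} = ⊤) :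
    B = ⊤ := by
  have hcol : ∀ i, single i 0 1 ∈ B := by
    have h1 : single 1 0 1 ∈ B := by
      convert B.mul_mem hu he using 1
      ext i j
      fin_cases i <;> fin_cases j <;> simp [Matrix.mul_apply, single_apply]
    have h2 : single 2 0 1 ∈ B := by
      convert B.mul_mem hu h1 using 1
      ext i j
      fin_cases i <;> fin_cases j <;> simp [Matrix.mul_apply, single_apply]
    intro i
    fin_cases i
    exacts [he, h1, h2]
  have hrow : ∀ j, single 0 j 1 ∈ B := by
    have h1 : single 0 1 1 ∈ B := by
      convert B.smul_mem (B.mul_mem he hv) p⁻¹ using 1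
      ext i j
      fin_cases i <;> fin_cases j <;>
        simp [Matrix.mul_apply, single_apply, smul_smul, hp]
    have h2 : single 0 2 1 ∈ B := by
      convert B.smul_mem (B.mul_mem h1 hv) q⁻¹ using 1
      ext i j
      fin_cases i <;> fin_cases j <;>
        simp [Matrix.mul_apply, single_apply, smul_smul, hq]
    intro j
    fin_cases j
    exacts [he, h1, h2]
  have hcorner : ∀ X : T, single 0 0 X ∈ B := by
    intro X
    have hX : X ∈ Algebra.adjoin K {S, Z} := hT ▸ Algebra.mem_top
    induction hX using Algebra.adjoin_induction with
    | mem X hX =>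
      obtain rfl | rfl := hX
      · convert B.mul_mem he (B.mul_mem hs he) using 1
        ext i j
        fin_cases i <;> fin_cases j <;>
          simp [Matrix.mul_apply, single_apply, vecMul, dotProduct]
      · convert B.mul_mem he (B.mul_mem hu (hcol 2)) using 1
        ext i j
        fin_cases i <;> fin_cases j <;>
          simp [Matrix.mul_apply, single_apply, vecMul, dotProduct]
    | algebraMap r =>
      convert B.smul_mem he r using 1
      rw [smul_single, Algebra.algebraMap_eq_smul_one]
    | add X Y _ _ hX hY =>
      rw [single_add]
      exact B.add_mem hX hY
    | mul X Y _ _ hX hY =>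
      convert B.mul_mem hX hY using 1
      rw [single_mul_single_same]
  refine eq_top_iff.2 fun M _ ↦ ?_
  rw [matrix_eq_sum_single M]
  refine B.sum_mem fun i _ ↦ B.sum_mem fun j _ ↦ ?_
  convert B.mul_mem (B.mul_mem (hcol i) (hcorner (M i j))) (hrow j) using 1
  simp

/-- A nondegenerate quadratic form has Clifford algebra `M₂`. -/
theorem adjoin_eq_top_of_nondegenerate {A B z : K} (h : B ^ 2 - 4 * A * z ^ 2 ≠ 0) :
    Algebra.adjoin K ({!![0, A; 1, 0], !![z, B; 0, -z]} : Set (Matrix (Fin 2) (Fin 2) K)) = ⊤ := by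
  set R := Algebra.adjoin K ({!![0, A; 1, 0], !![z, B; 0, -z]} : Set (Matrix (Fin 2) (Fin 2) K))
  have hS : !![0, A; 1, 0] ∈ R := Algebra.subset_adjoin (by simp)
  have hZ : !![z, B; 0, -z] ∈ R := Algebra.subset_adjoin (by simp)
  have h01 : !![0, 1; 0, 0] ∈ R := by
    convert R.smul_mem (R.mul_mem (R.add_mem hZ (R.smul_mem R.one_mem z))
      (R.sub_mem (R.mul_mem hS hZ) (R.smul_mem hS z))) (B ^ 2 - 4 * A * z ^ 2)⁻¹ using 1
    ext i j
    fin_cases i <;> fin_cases j <;> simp [Matrix.mul_apply]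
    field_simp
    ring
  have h11 : !![0, 0; 0, 1] ∈ R := by
    convert R.mul_mem hS h01 using 1
    ext i j
    fin_cases i <;> fin_cases j <;> simp
  refine eq_top_iff.2 fun M _ ↦ ?_
  have : M = M 0 0 • (1 - !![0, 0; 0, 1]) + M 0 1 • !![0, 1; 0, 0] +
      M 1 0 • (!![0, A; 1, 0] - A • !![0, 1; 0, 0]) + M 1 1 • !![0, 0; 0, 1] := by
    ext i j
    fin_cases i <;> fin_cases j <;> simp
  rw [this]
  exact R.add_mem (R.add_mem (R.add_mem (R.smul_mem (R.sub_mem R.one_mem h11) _)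
    (R.smul_mem h01 _)) (R.smul_mem (R.sub_mem hS (R.smul_mem h01 _)) _)) (R.smul_mem h11 _)

/-- The algebra of upper triangular `2 × 2` matrices. -/
def upperTriangular (K : Type) [Field K] : Subalgebra K (Matrix (Fin 2) (Fin 2) K) where
  carrier := {M | M 1 0 = 0}
  mul_mem' := by
    intro M N hM hN
    simp_all [Matrix.mul_apply]
  add_mem' := by
    intro M N hM hN
    simp_all
  algebraMap_mem' r := by simp [Matrix.algebraMap_matrix_apply]

/-- For a degenerate quadratic form, upper triangular matrices carry elements with the relations of
its Clifford algebra and a linear combination of them generating a nilpotent ideal. -/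
theorem exists_upperTriangular_of_degenerate [IsAlgClosed K] {A B C : K}
    (h : B ^ 2 = 4 * A * C) :
    ∃ (S Z : upperTriangular K) (l m : K), S * S = A • 1 ∧ Z * Z = C • 1 ∧
      S * Z + Z * S = B • 1 ∧ l • S + m • Z ≠ 0 ∧
      ∀ t : upperTriangular K, (l • S + m • Z) * t * (l • S + m • Z) = 0 := by
  obtain ⟨p, q, hp, hq, hpq⟩ : ∃ p q : K, p ^ 2 = A ∧ q ^ 2 = C ∧ 2 * p * q = B := by
    obtain ⟨p, hp⟩ := IsAlgClosed.exists_pow_nat_eq A (n := 2) (by norm_num)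
    obtain ⟨q, hq⟩ := IsAlgClosed.exists_pow_nat_eq C (n := 2) (by norm_num)
    have : (B - 2 * p * q) * (B + 2 * p * q) = 0 := by
      rw [← hp, ← hq] at h
      linear_combination h
    obtain h | h := mul_eq_zero.1 this
    · exact ⟨p, q, hp, hq, by linear_combination -h⟩
    · exact ⟨-p, q, by rw [neg_sq, hp], hq, by linear_combination -h⟩
  obtain ⟨l, m, p', q', h0, h1⟩ : ∃ l m p' q' : K, l * p + m * q = 0 ∧ l * p' + m * q' = 1 := by
    by_cases h : p = 0
    · exact ⟨1, 0, 1, 0, by simp [h], by simp⟩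
    · exact ⟨-q / p, 1, 0, 1, by field_simp; ring, by simp⟩
  let S : upperTriangular K := ⟨!![p, p'; 0, -p], rfl⟩
  let Z : upperTriangular K := ⟨!![q, q'; 0, -q], rfl⟩
  have hr : l • S + m • Z = (⟨!![0, 1; 0, 0], rfl⟩ : upperTriangular K) := by
    ext i j
    fin_cases i <;> fin_cases j <;> simp [S, Z, h0, h1]
    linear_combination -h0
  refine ⟨S, Z, l, m, ?_, ?_, ?_, ?_, ?_⟩
  · ext i j
    fin_cases i <;> fin_cases j <;> simp [S, ← hp] <;> ring
  · ext i j
    fin_cases i <;> fin_cases j <;> simp [Z, ← hq] <;> ring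
  · ext i j
    fin_cases i <;> fin_cases j <;> simp [S, Z, ← hpq] <;> ring
  · rw [hr]
    intro h
    simpa using congrFun₂ (congrArg Subtype.val h) 0 1
  · rintro ⟨t, ht⟩
    have ht : t 1 0 = 0 := ht
    rw [hr]
    ext i j
    fin_cases i <;> fin_cases j <;> simp [Matrix.mul_apply, vecMul, dotProduct, ht]

end BlockMatrices

section Semisimplicity

open Matrix

variable {K : Type} [Field K] {α1 α2 γ ω : K}

theorem exists_root_of_unity_three [IsAlgClosed K] (h2 : (2 : K) ≠ 0) :
    ∃ ω : K, ω ^ 2 + ω + 1 = 0 := by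
  obtain ⟨r, hr⟩ := IsAlgClosed.exists_pow_nat_eq (-3 : K) (n := 2) (by norm_num)
  exact ⟨(-1 + r) / 2, by field_simp; linear_combination hr⟩

theorem exists_pow_three_eq (h3 : (3 : K) ≠ 0) (hω : ω ^ 2 + ω + 1 = 0) (hγ : γ ≠ 0) (β : K) :
    ∃ δ, δ ^ 3 = γ ^ 3 ∧ δ ≠ 0 ∧ β + ω ^ 2 * δ ≠ 0 ∧ β + δ ≠ 0 := by
  have hω0 : ω ≠ 0 := by rintro rfl; simp at hω
  by_cases h0 : β + γ = 0
  · exact ⟨ω ^ 2 * γ, by grind, by simp [hω0, hγ], by grind, by grind⟩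
  by_cases h1 : β + ω ^ 2 * γ = 0
  · exact ⟨ω * γ, by grind, by simp [hω0, hγ], by grind, by grind⟩
  · exact ⟨γ, rfl, hγ, h1, h0⟩

theorem not_isSemisimpleRing_KAlg3_zero [IsAlgClosed K] (h3 : (3 : K) ≠ 0)
    (hω : ω ^ 2 + ω + 1 = 0) : ¬ IsSemisimpleRing (KAlg3 K α1 α2 0) := by
  intro h
  obtain ⟨x, hx⟩ := IsAlgClosed.exists_pow_nat_eq (9 * α1) (n := 2) (by norm_num)
  obtain ⟨φ, -, -, -, hφ⟩ := (isFourierTuple_nilpotent (α2 := α2) hω hx).exists_lift h3 hω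
  have hy : K3y K α1 α2 0 ≠ 0 := by
    intro h0
    rw [h0, map_zero] at hφ
    simpa using congrFun₂ hφ 2 0
  obtain ⟨c, hc⟩ := IsSemisimpleRing.exists_mul_mul_eq (K3y K α1 α2 0)
  obtain ⟨d, hd⟩ := exists_K3y_mul_eq c
  rw [hd] at hc
  apply hy
  calc K3y K α1 α2 0 = d * (d * K3y K α1 α2 0 * K3y K α1 α2 0) * K3y K α1 α2 0 := by rw [hc, hc]
    _ = d * (d * K3y K α1 α2 0 ^ 3) := by simp only [pow_three, mul_assoc]
    _ = 0 := by simp [K3y_pow_three]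

theorem nonempty_KAlg3_algEquiv_matrix [IsAlgClosed K] (h3 : (3 : K) ≠ 0)
    (hω : ω ^ 2 + ω + 1 = 0) (hγ : γ ≠ 0) {β : K} (hβ : 3 * α1 - α2 = β)
    (hP : β + ω ^ 2 * γ ≠ 0) (hQ : β + γ ≠ 0)
    (h : 4 * α1 * γ ^ 3 + β ^ 3 * (α1 + α2) ≠ 0) :
    Nonempty (KAlg3 K α1 α2 (γ ^ 3) ≃ₐ[K] Matrix (Fin 6) (Fin 6) K) := by
  obtain ⟨z, hz⟩ := IsAlgClosed.exists_pow_nat_eq (β ^ 3 + γ ^ 3) (n := 2) (by norm_num)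
  have hblock := isFourierTuple_block (T := Matrix (Fin 2) (Fin 2) K) (α1 := α1) (α2 := α2)
    (γ := γ) (S := !![0, 3 * α1 + 2 * α2 + γ; 1, 0])
    (Z := !![z, 2 * γ ^ 2 - 2 * β * γ - β ^ 2; 0, -z]) hω hβ
    (mul_inv_cancel₀ hP) (mul_inv_cancel₀ hQ)
    (by ext i j; fin_cases i <;> fin_cases j <;> simp)
    (by ext i j; fin_cases i <;> fin_cases j <;> simp [← hz] <;> ring)
    (by ext i j; fin_cases i <;> fin_cases j <;> (simp; try ring))
  obtain ⟨φ, hs, hu, hv, hy⟩ := hblock.exists_lift h3 hω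
  have hrange : φ.range = ⊤ := by
    refine eq_top_of_block_mem hP hQ φ.range ?_ ⟨_, hs⟩ ⟨_, hu⟩ ⟨_, hv⟩
      (adjoin_eq_top_of_nondegenerate ?_)
    · rw [← single_zero_zero_eq h3 hγ hω hy]
      exact ⟨(3 * γ ^ 2)⁻¹ • (K3y K α1 α2 (γ ^ 3) * K3y K α1 α2 (γ ^ 3) +
        γ • K3y K α1 α2 (γ ^ 3) + γ ^ 2 • 1), by simp⟩
    · rw [hz]
      subst hβ
      intro h0
      have h9 : (9 : K) ≠ 0 := by
        rw [show (9 : K) = 3 * 3 by norm_num]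
        exact mul_ne_zero h3 h3
      refine h ((mul_eq_zero.1 ?_).resolve_left h9)
      linear_combination -h0
  have hsurj : Function.Surjective φ := (AlgHom.range_eq_top φ).1 hrange
  obtain ⟨hfin, hle⟩ := KAlg3_finite_and_finrank_le (α1 := α1) (α2 := α2) (α3 := γ ^ 3) h3 hω
  have hM : Module.finrank K (Matrix (Fin 3) (Fin 3) (Matrix (Fin 2) (Fin 2) K)) = 36 := by
    simp [Module.finrank_matrix]
  have hge := LinearMap.finrank_le_finrank_of_surjective (f := φ.toLinearMap) hsurj
  have hinj : Function.Injective φ.toLinearMap :=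
    (LinearMap.injective_iff_surjective_of_finrank_eq_finrank (by omega)).2 hsurj
  exact ⟨((AlgEquiv.ofBijective φ ⟨hinj, hsurj⟩).trans
    (Matrix.compAlgEquiv (Fin 3) (Fin 2) K K)).trans
      (Matrix.reindexAlgEquiv K K finProdFinEquiv)⟩

theorem not_isSemisimpleRing_KAlg3 [IsAlgClosed K] (h3 : (3 : K) ≠ 0)
    (hω : ω ^ 2 + ω + 1 = 0) (hγ : γ ≠ 0) {β : K} (hβ : 3 * α1 - α2 = β)
    (hP : β + ω ^ 2 * γ ≠ 0) (hQ : β + γ ≠ 0)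
    (h : 4 * α1 * γ ^ 3 + β ^ 3 * (α1 + α2) = 0) :
    ¬ IsSemisimpleRing (KAlg3 K α1 α2 (γ ^ 3)) := by
  intro hss
  obtain ⟨S, Z, l, m, hS, hZ, hSZ, hr, hnil⟩ := exists_upperTriangular_of_degenerate
    (A := 3 * α1 + 2 * α2 + γ) (B := 2 * γ ^ 2 - 2 * β * γ - β ^ 2) (C := β ^ 3 + γ ^ 3)
    (by subst hβ; linear_combination -9 * h)
  have hblock := isFourierTuple_block hω hβ (mul_inv_cancel₀ hP) (mul_inv_cancel₀ hQ) hS hZ hSZ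
  obtain ⟨φ, hs, hu, -, hy⟩ := hblock.exists_lift h3 hω
  set s := K3a K α1 α2 (γ ^ 3) + K3b K α1 α2 (γ ^ 3) + K3c K α1 α2 (γ ^ 3)
  set u := K3a K α1 α2 (γ ^ 3) + ω • K3b K α1 α2 (γ ^ 3) + ω ^ 2 • K3c K α1 α2 (γ ^ 3)
  set y := K3y K α1 α2 (γ ^ 3)
  set x := (3 * γ ^ 2)⁻¹ • (y * y + γ • y + γ ^ 2 • 1) * (l • s + m • u ^ 3)
  have hx : φ x = single 0 0 (l • S + m • Z) := by
    have hx' : φ x = (3 * γ ^ 2)⁻¹ • (φ y * φ y + γ • φ y + γ ^ 2 • 1) *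
        (l • φ s + m • φ u ^ 3) := by
      simp only [x, map_mul, map_smul, map_add, map_pow, map_one]
    rw [hx', single_zero_zero_eq h3 hγ hω hy, hs, hu]
    ext i j : 2
    fin_cases i <;> fin_cases j <;>
      simp [pow_three, Matrix.mul_apply, single_apply]
  obtain ⟨c, hc⟩ := IsSemisimpleRing.exists_mul_mul_eq x
  apply hr
  have := congrArg φ hc
  rw [map_mul, map_mul, hx] at this
  have := congrFun₂ this 0 0
  simpa [Matrix.mul_apply, single_apply, Fin.sum_univ_three, hnil] using this.symm

end Semisimplicity

theorem KAlg3_radical_semisimple (K : Type) [Field K] [IsAlgClosed K]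
    (h2 : ringChar K ≠ 2) (h3 : ringChar K ≠ 3) (α1 α2 γ : K) :
    let β := 3 * α1 - α2
    -- (1) if `γ = 0` then the two-sided ideal generated by `y` is nilpotent and
    -- `𝒦(α₁, α₂, 0)` is not semisimple
    (γ = 0 →
      (∃ n : ℕ, 0 < n ∧ ∀ f : Fin n → KAlg3 K α1 α2 0,
        (∀ i, f i ∈ TwoSidedIdeal.span ({K3y K α1 α2 0} : Set (KAlg3 K α1 α2 0))) →
          (List.ofFn f).prod = 0) ∧
      ¬ IsSemisimpleRing (KAlg3 K α1 α2 0)) ∧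
    -- (2) if `γ ≠ 0` then `𝒦(α₁, α₂, γ³)` is semisimple iff `4α₁γ³ + β³(α₁+α₂) ≠ 0`,
    -- and in that case it is isomorphic to `M₆(K)`
    (γ ≠ 0 →
      (IsSemisimpleRing (KAlg3 K α1 α2 (γ ^ 3)) ↔
        4 * α1 * γ ^ 3 + β ^ 3 * (α1 + α2) ≠ 0) ∧
      (4 * α1 * γ ^ 3 + β ^ 3 * (α1 + α2) ≠ 0 →
        Nonempty (KAlg3 K α1 α2 (γ ^ 3) ≃ₐ[K] Matrix (Fin 6) (Fin 6) K))) := by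
  intro β
  have hchar : ∀ p : ℕ, p.Prime → ringChar K ≠ p → (p : K) ≠ 0 := by
    intro p hp hne h0
    obtain h | h := (Nat.dvd_prime hp).1 ((ringChar.spec K p).1 h0)
    · exact CharP.ringChar_ne_one h
    · exact hne h
  have h2' : (2 : K) ≠ 0 := by exact_mod_cast hchar 2 Nat.prime_two h2
  have h3' : (3 : K) ≠ 0 := by exact_mod_cast hchar 3 Nat.prime_three h3
  obtain ⟨ω, hω⟩ := exists_root_of_unity_three h2'
  refine ⟨fun _ ↦ ⟨⟨3, by norm_num, fun f hf ↦ ?_⟩, not_isSemisimpleRing_KAlg3_zero h3' hω⟩,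
    fun hγ ↦ ?_⟩
  · simpa [List.ofFn_succ] using mul_mul_eq_zero_of_mem_span_K3y (hf 0) (hf 1) (hf 2)
  obtain ⟨δ, hδ, hδ0, hP, hQ⟩ := exists_pow_three_eq h3' hω hγ β
  rw [← hδ]
  have hequiv := nonempty_KAlg3_algEquiv_matrix h3' hω hδ0 (β := β) rfl hP hQ
  refine ⟨⟨fun hss h0 ↦ not_isSemisimpleRing_KAlg3 h3' hω hδ0 rfl hP hQ h0 hss, fun h ↦ ?_⟩,
    hequiv⟩
  obtain ⟨e⟩ := hequiv h
  exact e.symm.toRingEquiv.isSemisimpleRing
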